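/- arXiv:1806.06732 — 3 statements merged into one kernel-verified Lean document; each statement's English description precedes it below -/
import Mathlib

section
/- Let n be a positive integer, η, Δt, λ ∈ ℝ with 2 + ηΔt ≠ 0, and let F be a real n×n matrix possessing an eigenvector v ≠ 0 with F v = −λ v. Let A be the 2n×2n block matrix A = (2/(2+ηΔt)) · [[(1 + ηΔt/2)·I + (Δt²/2)·F , Δt·I], [(Δt/2)·F , I]] (blocks of size n×n). Suppose b = η − Δt·λ satisfies b² − 8λ ≥ 0, and let μ = (2/(2+ηΔt)) · (1 + (Δt/4)(b + s·√(b² − 8λ))) for either sign s ∈ {+1, −1}. Then μ is an eigenvalue of A: there exists a nonzero vector w ∈ ℝ^{2n} with A w = μ w. -/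
/-- Eigenvalues of the Störmer–Verlet one-step block matrix `A` (equation (4.5)):
if `F v = −λ v` then `μ = (2/(2+ηΔt))·(1 + (Δt/4)(b ± √(b² − 8λ)))`, with
`b = η − Δt·λ` and `b² − 8λ ≥ 0`, is an eigenvalue of `A`. -/
theorem stmt_3 (n : ℕ) (hn : 0 < n) (η Δt lam : ℝ) (hne : 2 + η * Δt ≠ 0)
    (F : Matrix (Fin n) (Fin n) ℝ) (v : Fin n → ℝ) (hv : v ≠ 0)
    (heig : F.mulVec v = (-lam) • v)
    (b : ℝ) (hb : b = η - Δt * lam) (hdisc : 0 ≤ b ^ 2 - 8 * lam)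
    (s : ℝ) (hs : s = 1 ∨ s = -1)
    (μ : ℝ)
    (hμ : μ = (2 / (2 + η * Δt)) *
      (1 + (Δt / 4) * (b + s * Real.sqrt (b ^ 2 - 8 * lam)))) :
    ∃ w : (Fin n ⊕ Fin n) → ℝ, w ≠ 0 ∧
      Matrix.mulVec
        ((2 / (2 + η * Δt)) • Matrix.fromBlocks
          ((1 + η * Δt / 2) • (1 : Matrix (Fin n) (Fin n) ℝ) + (Δt ^ 2 / 2) • F)
          (Δt • (1 : Matrix (Fin n) (Fin n) ℝ))
          ((Δt / 2) • F)
          (1 : Matrix (Fin n) (Fin n) ℝ)) w = μ • w := by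
  have hsq : (s * Real.sqrt (b ^ 2 - 8 * lam)) ^ 2 = b ^ 2 - 8 * lam := by
    rw [mul_pow, Real.sq_sqrt hdisc]
    rcases hs with rfl | rfl <;> ring
  generalize s * Real.sqrt (b ^ 2 - 8 * lam) = r at hsq hμ
  refine ⟨Sum.elim v (((r - b) / 4) • v), fun h => hv ?_, ?_⟩
  · ext i
    simpa using congrFun h (Sum.inl i)
  · rw [Matrix.smul_mulVec, Matrix.fromBlocks_mulVec, hμ, mul_smul]
    congr 1
    ext (i | i)
    · simp [Matrix.add_mulVec, Matrix.smul_mulVec, Matrix.mulVec_smul, heig]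
      subst hb
      ring
    · simp [Matrix.smul_mulVec, heig]
      linear_combination (-(Δt * v i) / 16) * hsq
end

section
/- Let Δt > 0, λ > 0, and 0 ≤ a < 1 be real numbers, and set η = Δt·λ + a·√(8λ). Then (1 + a·Δt·√(2λ) + (Δt²/2)·λ) / (1 + (Δt/2)·η)² < 1. -/
/-- Underdamped case in the proof of Theorem 4.3. -/
theorem stmt_6 (Δt lam a : ℝ) (hΔt : 0 < Δt) (hlam : 0 < lam)
    (ha0 : 0 ≤ a) (ha1 : a < 1)
    (η : ℝ) (hη : η = Δt * lam + a * Real.sqrt (8 * lam)) :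
    (1 + a * Δt * Real.sqrt (2 * lam) + (Δt ^ 2 / 2) * lam) /
      (1 + (Δt / 2) * η) ^ 2 < 1 := by
  have h_sqrt : Real.sqrt (8 * lam) = 2 * Real.sqrt (2 * lam) := by
    rw [show 8 * lam = 2 ^ 2 * (2 * lam) by ring, Real.sqrt_mul (by positivity),
      Real.sqrt_sq zero_le_two]
  have h_base : 1 + (Δt / 2) * η =
      1 + a * Δt * Real.sqrt (2 * lam) + (Δt ^ 2 / 2) * lam := by
    rw [hη, h_sqrt]
    ring
  have h_one_lt : 1 < 1 + a * Δt * Real.sqrt (2 * lam) + (Δt ^ 2 / 2) * lam := by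
    have : 0 ≤ a * Δt * Real.sqrt (2 * lam) := by positivity
    have : 0 < (Δt ^ 2 / 2) * lam := by positivity
    linarith
  rw [h_base, div_lt_one (by positivity)]
  exact lt_self_pow₀ h_one_lt one_lt_two
end

section
/- Let E be a real normed vector space, let u : [0,∞) → E be continuous with u(0) = u₀ ≠ 0, let C, c, μ > 0, and suppose there exists u_∞ ∈ E with ‖u(t) − u_∞‖ ≤ C·e^{−c·t} for all t ≥ 0 and ‖u_∞ − u₀‖ ≥ μ. Let 0 < δ < μ/‖u₀‖. Then the discrepancy function χ(T) = ‖u(T) − u₀‖/‖u₀‖ − δ admits at least one positive root: there exists T > 0 with ‖u(T) − u₀‖ = δ·‖u₀‖. Moreover, for any such T and any ū ∈ E with ‖u₀ − ū‖ ≤ δ, one has ‖u(T) − ū‖ ≤ (‖u₀‖ + 1)·δ. -/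
/-- Theorem 3.4 (a posteriori selection method for `T(δ)`, modified Morozov
discrepancy principle): the discrepancy function admits a positive root, and for
any such root `T` the approximation `u(T)` is within `(‖u₀‖+1)·δ` of any `ū`
with `‖u₀ − ū‖ ≤ δ`. -/
theorem stmt_12 {E : Type*} [NormedAddCommGroup E]
    (u : ℝ → E) (u₀ : E) (hcont : ContinuousOn u (Set.Ici (0 : ℝ)))
    (hu0 : u 0 = u₀) (hu0ne : u₀ ≠ 0)
    (C c μ : ℝ) (hC : 0 < C) (hc : 0 < c) (hμ : 0 < μ)
    (uinf : E) (hdecay : ∀ t ≥ (0 : ℝ), ‖u t - uinf‖ ≤ C * Real.exp (-c * t))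
    (hfar : μ ≤ ‖uinf - u₀‖)
    (δ : ℝ) (hδ0 : 0 < δ) (hδμ : δ < μ / ‖u₀‖) :
    (∃ T > (0 : ℝ), ‖u T - u₀‖ = δ * ‖u₀‖) ∧
      ∀ T > (0 : ℝ), ‖u T - u₀‖ = δ * ‖u₀‖ →
        ∀ ubar : E, ‖u₀ - ubar‖ ≤ δ → ‖u T - ubar‖ ≤ (‖u₀‖ + 1) * δ := by
  have hlt : δ * ‖u₀‖ < μ := (lt_div_iff₀ (norm_pos_iff.mpr hu0ne)).mp hδμ
  have hpos : 0 < δ * ‖u₀‖ := mul_pos hδ0 (norm_pos_iff.mpr hu0ne)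
  refine ⟨?_, fun T _ hT ubar hubar => ?_⟩
  · have hlim : Filter.Tendsto (fun t : ℝ => C * Real.exp (-c * t)) Filter.atTop (nhds 0) := by
      simpa using (Real.tendsto_exp_atBot.comp
        (Filter.tendsto_id.const_mul_atTop_of_neg (neg_lt_zero.mpr hc))).const_mul C
    obtain ⟨S, hS, hS0⟩ := ((hlim.eventually_lt_const (sub_pos.mpr hlt)).and
      (Filter.eventually_ge_atTop (0 : ℝ))).exists
    have hfarS : δ * ‖u₀‖ ≤ ‖u S - u₀‖ := by
      have htri := norm_sub_le_norm_sub_add_norm_sub uinf (u S) u₀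
      rw [norm_sub_rev uinf (u S)] at htri
      linarith [hdecay S hS0]
    have hcontS : ContinuousOn (fun t => ‖u t - u₀‖) (Set.Icc 0 S) :=
      ((hcont.mono Set.Icc_subset_Ici_self).sub continuousOn_const).norm
    obtain ⟨T, hT, hTeq⟩ := intermediate_value_Icc hS0 hcontS
      ⟨by simpa [hu0] using hpos.le, hfarS⟩
    refine ⟨T, hT.1.lt_of_ne ?_, hTeq⟩
    rintro rfl
    simp only [hu0, sub_self, norm_zero] at hTeq
    exact hpos.ne hTeq
  · calc ‖u T - ubar‖ ≤ ‖u T - u₀‖ + ‖u₀ - ubar‖ := norm_sub_le_norm_sub_add_norm_sub _ _ _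
      _ ≤ (‖u₀‖ + 1) * δ := by linarith
end
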